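/- arXiv:0808.2942 — 2 statements merged into one kernel-verified Lean document; each statement's English description precedes it below -/
import Mathlib

section
/- Let I be a nonempty set. Then ℓ¹(I) is a two-sided M_I-induced module: the canonical maps M_I ⊗̂_{M_I} ℓ¹(I) → ℓ¹(I), a ⊗ x ↦ a·x, and ℓ¹(I) ⊗̂_{M_I} M_I → ℓ¹(I), x ⊗ a ↦ x·a, are topological isomorphisms. -/
open scoped TensorProduct BigOperators ENNReal
open Filter

noncomputable section

/-- `ℓ¹(X)`: the Banach space of absolutely summable complex functions on `X`. -/
abbrev L1 (X : Type) : Type := lp (fun _ : X => ℂ) 1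

open Classical in
/-- The point mass `δ_x` in `ℓ¹(X)`. -/
noncomputable def delta {X : Type} (x : X) : L1 X := lp.single 1 x (1 : ℂ)

/-- The projective tensor norm of an element of the algebraic tensor product
`E ⊗[ℂ] F`: the infimum of `∑ ‖xᵢ‖ ‖yᵢ‖` over all finite representations
`z = ∑ xᵢ ⊗ yᵢ`. -/
def projNorm {E F : Type} [SeminormedAddCommGroup E] [NormedSpace ℂ E]
    [SeminormedAddCommGroup F] [NormedSpace ℂ F] (z : E ⊗[ℂ] F) : ℝ :=
  sInf {r : ℝ | ∃ (n : ℕ) (x : Fin n → E) (y : Fin n → F),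
    z = ∑ i, x i ⊗ₜ[ℂ] y i ∧ r = ∑ i, ‖x i‖ * ‖y i‖}

/-- `(T, φ)` is a realization of the completed projective tensor product `E ⊗̂ F`:
`T` is a Banach space, the canonical map from the algebraic tensor product is an
isometry with respect to the projective tensor norm, and it has dense range. -/
structure IsProjTensor (E F T : Type) [SeminormedAddCommGroup E] [NormedSpace ℂ E]
    [SeminormedAddCommGroup F] [NormedSpace ℂ F]
    [SeminormedAddCommGroup T] [NormedSpace ℂ T]
    (φ : E →ₗ[ℂ] F →ₗ[ℂ] T) : Prop where
  complete : CompleteSpace T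
  isometry : ∀ z : E ⊗[ℂ] F, ‖TensorProduct.lift φ z‖ = projNorm z
  dense : DenseRange ⇑(TensorProduct.lift φ)

/-- The closed linear span of the `A`-balancing relations
`{x·a ⊗ y - x ⊗ a·y}` inside a realization `T` of `E ⊗̂ F`; the quotient
`T ⧸ balancer φ r l` is the `A`-module tensor product `E ⊗̂_A F`. -/
def balancer {A E F T : Type} [SeminormedAddCommGroup E] [NormedSpace ℂ E]
    [SeminormedAddCommGroup F] [NormedSpace ℂ F]
    [SeminormedAddCommGroup T] [NormedSpace ℂ T]
    (φ : E →ₗ[ℂ] F →ₗ[ℂ] T) (r : E → A → E) (l : A → F → F) : Submodule ℂ T :=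
  (Submodule.span ℂ {z : T | ∃ (x : E) (a : A) (y : F), z = φ (r x a) y - φ x (l a y)}).topologicalClosure

/-- A left Banach `A`-module `(E, l)` is `A`-induced: for every realization `T` of
`A ⊗̂ E`, the canonical map `A ⊗̂_A E → E`, `a ⊗ x ↦ a·x`, is a topological
isomorphism. -/
def LeftInduced {A E : Type} [SeminormedAddCommGroup A] [NormedSpace ℂ A]
    [SeminormedAddCommGroup E] [NormedSpace ℂ E]
    (mulA : A →L[ℂ] A →L[ℂ] A) (l : A →L[ℂ] E →L[ℂ] E) : Prop :=
  ∀ (T : Type) [SeminormedAddCommGroup T] [NormedSpace ℂ T]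
    (φ : A →ₗ[ℂ] E →ₗ[ℂ] T), IsProjTensor A E T φ →
    ∃ e : (T ⧸ balancer φ (fun a b => mulA a b) (fun a x => l a x)) ≃L[ℂ] E,
      ∀ (a : A) (x : E), e (Submodule.Quotient.mk (φ a x)) = l a x

/-- A right Banach `A`-module `(E, r)` is `A`-induced. -/
def RightInduced {A E : Type} [SeminormedAddCommGroup A] [NormedSpace ℂ A]
    [SeminormedAddCommGroup E] [NormedSpace ℂ E]
    (mulA : A →L[ℂ] A →L[ℂ] A) (r : E →L[ℂ] A →L[ℂ] E) : Prop :=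
  ∀ (T : Type) [SeminormedAddCommGroup T] [NormedSpace ℂ T]
    (φ : E →ₗ[ℂ] A →ₗ[ℂ] T), IsProjTensor E A T φ →
    ∃ e : (T ⧸ balancer φ (fun x a => r x a) (fun a b => mulA a b)) ≃L[ℂ] E,
      ∀ (x : E) (a : A), e (Submodule.Quotient.mk (φ x a)) = r x a

/-- A Banach algebra `(A, mul)` is self-induced: the multiplication map
`A ⊗̂_A A → A` is an isomorphism of `A`-bimodules. -/
def SelfInduced {A : Type} [SeminormedAddCommGroup A] [NormedSpace ℂ A]
    (mulA : A →L[ℂ] A →L[ℂ] A) : Prop :=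
  ∀ (T : Type) [SeminormedAddCommGroup T] [NormedSpace ℂ T]
    (φ : A →ₗ[ℂ] A →ₗ[ℂ] T), IsProjTensor A A T φ →
    ∃ e : (T ⧸ balancer φ (fun a b => mulA a b) (fun a b => mulA a b)) ≃L[ℂ] A,
      (∀ a b : A, e (Submodule.Quotient.mk (φ a b)) = mulA a b) ∧
      (∀ c a b : A, e (Submodule.Quotient.mk (φ (mulA c a) b))
          = mulA c (e (Submodule.Quotient.mk (φ a b)))) ∧
      (∀ a b c : A, e (Submodule.Quotient.mk (φ a (mulA b c)))
          = mulA (e (Submodule.Quotient.mk (φ a b))) c)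

/-- `(E, l, r)` is a Banach bimodule: left over `(A, mulL)`, right over `(B, mulR)`. -/
def IsBimoduleLaw {A B E : Type} [SeminormedAddCommGroup A] [NormedSpace ℂ A]
    [SeminormedAddCommGroup B] [NormedSpace ℂ B]
    [SeminormedAddCommGroup E] [NormedSpace ℂ E]
    (mulL : A →L[ℂ] A →L[ℂ] A) (mulR : B →L[ℂ] B →L[ℂ] B)
    (l : A →L[ℂ] E →L[ℂ] E) (r : E →L[ℂ] B →L[ℂ] E) : Prop :=
  (∀ (a a' : A) (x : E), l (mulL a a') x = l a (l a' x)) ∧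
  (∀ (x : E) (b b' : B), r (r x b) b' = r x (mulR b b')) ∧
  (∀ (a : A) (x : E) (b : B), r (l a x) b = l a (r x b))

theorem l1_summable {X : Type} (a : L1 X) : Summable fun x => ‖a x‖ := by
  simpa using (lp.memℓp a).summable (by simp)

theorem l1_norm {X : Type} (a : L1 X) : ‖a‖ = ∑' x, ‖a x‖ := by
  rw [lp.norm_eq_tsum_rpow (by simp)]
  simp

theorem delta_apply' {X : Type} [DecidableEq X] (x y : X) :
    (delta x : L1 X) y = if y = x then 1 else 0 := by
  classical
  unfold delta
  by_cases h : y = x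
  · subst h; simp
  · simp [h]

theorem norm_delta {X : Type} (x : X) : ‖(delta x : L1 X)‖ = 1 := by
  classical
  unfold delta
  rw [lp.norm_single (by simp)]
  simp

theorem l1_ext {X B : Type} [AddCommMonoid B] [Module ℂ B] [TopologicalSpace B] [T2Space B]
    (f g : L1 X →L[ℂ] B) (h : ∀ x, f (delta x) = g (delta x)) : f = g := by
  classical
  refine lp.ext_continuousLinearMap (by simp) fun i => ?_
  ext
  have := h i
  unfold delta at this
  simp only [ContinuousLinearMap.comp_apply, lp.singleContinuousLinearMap_apply]
  convert this

section
variable {X Y B : Type} [NormedAddCommGroup B] [NormedSpace ℂ B] [CompleteSpace B]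

theorem lift_bd (v : X → B) (hv : ∀ x, ‖v x‖ ≤ 1) (a : L1 X) (x : X) :
    ‖a x • v x‖ ≤ ‖a x‖ := by
  rw [norm_smul]
  exact mul_le_of_le_one_right (norm_nonneg _) (hv x)

theorem lift_summable_norm (v : X → B) (hv : ∀ x, ‖v x‖ ≤ 1) (a : L1 X) :
    Summable fun x => ‖a x • v x‖ :=
  Summable.of_nonneg_of_le (fun _ => norm_nonneg _) (lift_bd v hv a) (l1_summable a)

theorem lift_summable (v : X → B) (hv : ∀ x, ‖v x‖ ≤ 1) (a : L1 X) :
    Summable fun x => a x • v x := (lift_summable_norm v hv a).of_norm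

/-- The operator `ℓ¹(X) → B` determined by a family in the unit ball. -/
def lift1 (v : X → B) (hv : ∀ x, ‖v x‖ ≤ 1) : L1 X →L[ℂ] B :=
  LinearMap.mkContinuous
    { toFun := fun a => ∑' x, a x • v x
      map_add' := fun a b => by
        rw [← (lift_summable v hv a).tsum_add (lift_summable v hv b)]
        simp [add_smul]
      map_smul' := fun c a => by
        rw [RingHom.id_apply, ← (lift_summable v hv a).tsum_const_smul]
        simp [mul_smul] } 1
    (fun a => by
      rw [one_mul, l1_norm]
      exact (norm_tsum_le_tsum_norm (lift_summable_norm v hv a)).trans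
        ((lift_summable_norm v hv a).tsum_le_tsum (lift_bd v hv a) (l1_summable a)))

theorem lift1_apply (v : X → B) (hv : ∀ x, ‖v x‖ ≤ 1) (a : L1 X) :
    lift1 v hv a = ∑' x, a x • v x := rfl

theorem lift1_norm (v : X → B) (hv : ∀ x, ‖v x‖ ≤ 1) : ‖lift1 v hv‖ ≤ 1 :=
  LinearMap.mkContinuous_norm_le _ zero_le_one _

theorem lift1_delta (v : X → B) (hv : ∀ x, ‖v x‖ ≤ 1) (x : X) :
    lift1 v hv (delta x) = v x := by
  classical
  rw [lift1_apply, tsum_eq_single x]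
  · simp [delta_apply']
  · intro y hy
    simp [delta_apply', hy]

/-- The bilinear operator determined by a doubly indexed family in the unit ball. -/
def lift2 (v : X → Y → B) (hv : ∀ x y, ‖v x y‖ ≤ 1) : L1 X →L[ℂ] L1 Y →L[ℂ] B :=
  lift1 (fun x => lift1 (v x) (hv x)) (fun x => lift1_norm (v x) (hv x))

theorem lift2_delta (v : X → Y → B) (hv : ∀ x y, ‖v x y‖ ≤ 1) (x : X) (y : Y) :
    lift2 v hv (delta x) (delta y) = v x y := by
  rw [lift2, lift1_delta, lift1_delta]

end

theorem l1_tsum_apply {X Z : Type} (v : X → L1 Z) (hv : Summable v) (z : Z) :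
    (∑' x, v x) z = ∑' x, v x z :=
  (lp.evalCLM ℂ (fun _ : Z => ℂ) 1 z).map_tsum hv

theorem lift2_coord {X Y Z : Type} (v : X → Y → L1 Z) (hv : ∀ x y, ‖v x y‖ ≤ 1)
    (a : L1 X) (b : L1 Y) (z : Z) :
    lift2 v hv a b z = ∑' x, a x * ∑' y, b y * v x y z := by
  have h1 : lift2 v hv a b = ∑' x, a x • lift1 (v x) (hv x) b := by
    rw [lift2, lift1_apply]
    exact (ContinuousLinearMap.apply ℂ (L1 Z) b).map_tsum
      (lift_summable (fun x => lift1 (v x) (hv x)) (fun x => lift1_norm (v x) (hv x)) a)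
  rw [h1, l1_tsum_apply]
  · refine tsum_congr fun x => ?_
    rw [lp.coeFn_smul, Pi.smul_apply, smul_eq_mul, lift1_apply,
      l1_tsum_apply _ (lift_summable (v x) (hv x) b)]
    rfl
  · exact ((ContinuousLinearMap.apply ℂ (L1 Z) b).hasSum
      (lift_summable (fun x => lift1 (v x) (hv x)) (fun x => lift1_norm (v x) (hv x)) a).hasSum).summable

theorem projNorm_tmul_le {E F : Type} [SeminormedAddCommGroup E] [NormedSpace ℂ E]
    [SeminormedAddCommGroup F] [NormedSpace ℂ F] (x : E) (y : F) :
    projNorm (x ⊗ₜ[ℂ] y) ≤ ‖x‖ * ‖y‖ := by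
  refine csInf_le ⟨0, ?_⟩ ⟨1, fun _ => x, fun _ => y, by simp, by simp⟩
  rintro r ⟨n, x, y, -, rfl⟩
  positivity

theorem lift_le_projNorm {E F G : Type} [SeminormedAddCommGroup E] [NormedSpace ℂ E]
    [SeminormedAddCommGroup F] [NormedSpace ℂ F] [SeminormedAddCommGroup G] [NormedSpace ℂ G]
    (m : E →L[ℂ] F →L[ℂ] G) (f : E ⊗[ℂ] F →ₗ[ℂ] G) (hf : ∀ x y, f (x ⊗ₜ y) = m x y)
    (z : E ⊗[ℂ] F) : ‖f z‖ ≤ ‖m‖ * projNorm z := by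
  have key : ∀ r ∈ {r : ℝ | ∃ (n : ℕ) (x : Fin n → E) (y : Fin n → F),
      z = ∑ i, x i ⊗ₜ[ℂ] y i ∧ r = ∑ i, ‖x i‖ * ‖y i‖}, ‖f z‖ ≤ ‖m‖ * r := by
    rintro r ⟨n, x, y, rfl, rfl⟩
    rw [map_sum, Finset.mul_sum]
    refine (norm_sum_le _ _).trans (Finset.sum_le_sum fun i _ => ?_)
    rw [hf, ← mul_assoc]
    exact m.le_opNorm₂ _ _
  have hne : {r : ℝ | ∃ (n : ℕ) (x : Fin n → E) (y : Fin n → F),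
      z = ∑ i, x i ⊗ₜ[ℂ] y i ∧ r = ∑ i, ‖x i‖ * ‖y i‖}.Nonempty := by
    obtain ⟨S, rfl⟩ := TensorProduct.exists_finset z
    refine ⟨_, S.card, fun i => (S.equivFin.symm i).1.1, fun i => (S.equivFin.symm i).1.2, ?_, rfl⟩
    rw [← Finset.sum_coe_sort S, ← S.equivFin.symm.sum_comp]
  rcases (norm_nonneg m).eq_or_lt with h0 | hpos
  · obtain ⟨r, hr⟩ := hne
    have := key r hr
    rw [← h0] at this ⊢
    simpa using this
  · rw [← div_le_iff₀' hpos]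
    exact le_csInf hne fun r hr => by
      rw [div_le_iff₀' hpos]
      exact key r hr

theorem induced_key {A X Y I T : Type} [SeminormedAddCommGroup T] [NormedSpace ℂ T]
    (φ : L1 X →ₗ[ℂ] L1 Y →ₗ[ℂ] T) (hφ : IsProjTensor (L1 X) (L1 Y) T φ)
    (r : L1 X → A → L1 X) (l : A → L1 Y → L1 Y)
    (m : L1 X →L[ℂ] L1 Y →L[ℂ] L1 I)
    (hbal : ∀ x a y, m (r x a) y = m x (l a y))
    (p : I → L1 X) (q : I → L1 Y) (hp : ∀ i, ‖p i‖ ≤ 1) (hq : ∀ i, ‖q i‖ ≤ 1)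
    (hm : ∀ i, m (p i) (q i) = delta i)
    (hb : ∀ x y, (∃ i, m (delta x) (delta y) = delta i ∧
        φ (delta x) (delta y) - φ (p i) (q i) ∈ balancer φ r l) ∨
      (m (delta x) (delta y) = 0 ∧ φ (delta x) (delta y) ∈ balancer φ r l)) :
    ∃ e : (T ⧸ balancer φ r l) ≃L[ℂ] L1 I,
      ∀ x y, e (Submodule.Quotient.mk (φ x y)) = m x y := by
  have := hφ.complete
  have hcl : IsClosed (balancer φ r l : Set T) := Submodule.isClosed_topologicalClosure _
  have hφn : ∀ x y, ‖φ x y‖ ≤ 1 * ‖x‖ * ‖y‖ := fun x y => by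
    rw [one_mul, ← TensorProduct.lift.tmul (f' := φ), hφ.isometry]
    exact projNorm_tmul_le x y
  let φc : L1 X →L[ℂ] L1 Y →L[ℂ] T := φ.mkContinuous₂ 1 hφn
  let f : L1 X ⊗[ℂ] L1 Y →ₗ[ℂ] L1 I :=
    TensorProduct.lift ((ContinuousLinearMap.coeLM ℂ).comp m.toLinearMap)
  have hf : ∀ x y, f (x ⊗ₜ y) = m x y := fun x y => rfl
  let μ : T →L[ℂ] L1 I := f.extendOfNorm (TensorProduct.lift φ)
  have hμ : ∀ x y, μ (φ x y) = m x y := fun x y => by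
    have := LinearMap.extendOfNorm_eq (f := f) hφ.dense
      ⟨‖m‖, fun z => by rw [hφ.isometry]; exact lift_le_projNorm m f hf z⟩ (x ⊗ₜ y)
    rwa [hf, TensorProduct.lift.tmul] at this
  have hker : balancer φ r l ≤ μ.ker := by
    refine Submodule.topologicalClosure_minimal _ ?_ μ.isClosed_ker
    rw [Submodule.span_le]
    rintro _ ⟨x, a, y, rfl⟩
    simp [hμ, hbal]
  let μQ : (T ⧸ balancer φ r l) →L[ℂ] L1 I := (balancer φ r l).liftQL μ hker
  have hμQ : ∀ t, μQ (Submodule.Quotient.mk t) = μ t := fun t => rfl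
  let s : L1 I →L[ℂ] (T ⧸ balancer φ r l) :=
    lift1 (fun i => (Submodule.Quotient.mk (φ (p i) (q i)) : T ⧸ balancer φ r l)) (fun i => by
      refine (Submodule.Quotient.norm_mk_le _ _).trans ((hφn _ _).trans ?_)
      rw [one_mul]
      exact mul_le_one₀ (hp i) (norm_nonneg _) (hq i))
  have hs : ∀ i, s (delta i) = Submodule.Quotient.mk (φ (p i) (q i)) := fun i => lift1_delta _ _ i
  have h1 : μQ.comp s = ContinuousLinearMap.id ℂ _ := by
    refine l1_ext _ _ fun i => ?_
    simp [hs, hμQ, hμ, hm]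
  have h2 : ∀ x y, s (m x y) = Submodule.Quotient.mk (φ x y) := by
    have : (ContinuousLinearMap.compL ℂ (L1 Y) (L1 I) (T ⧸ balancer φ r l) s).comp m
        = (ContinuousLinearMap.compL ℂ (L1 Y) T (T ⧸ balancer φ r l)
            (balancer φ r l).mkQL).comp φc := by
      refine l1_ext _ _ fun x => l1_ext _ _ fun y => ?_
      change s (m (delta x) (delta y)) = Submodule.Quotient.mk (φ (delta x) (delta y))
      rcases hb x y with ⟨i, h, h'⟩ | ⟨h, h'⟩
      · rw [h, hs]
        exact ((Submodule.Quotient.eq _).2 h').symm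
      · rw [h, map_zero]
        exact ((Submodule.Quotient.mk_eq_zero _).2 h').symm
    intro x y
    exact DFunLike.congr_fun (DFunLike.congr_fun this x) y
  have h3 : ∀ t : T, s (μ t) = Submodule.Quotient.mk t := by
    intro t
    refine hφ.dense.induction_on (p := fun t => s (μ t) = (Submodule.Quotient.mk t : T ⧸ balancer φ r l)) t
      (isClosed_eq (s.continuous.comp μ.continuous) (balancer φ r l).mkQL.continuous) ?_
    intro z
    induction z with
    | zero => simp
    | tmul x y => rw [TensorProduct.lift.tmul, hμ, h2]
    | add a b ha hb => rw [map_add, map_add, map_add, ha, hb, Submodule.Quotient.mk_add]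
  refine ⟨ContinuousLinearEquiv.equivOfInverse μQ s ?_ ?_, ?_⟩
  · intro t
    obtain ⟨t, rfl⟩ := Submodule.Quotient.mk_surjective _ t
    exact h3 t
  · intro x
    exact DFunLike.congr_fun h1 x
  · intro x y
    exact hμ x y

theorem balancer_mem {A E F T : Type} [SeminormedAddCommGroup E] [NormedSpace ℂ E]
    [SeminormedAddCommGroup F] [NormedSpace ℂ F]
    [SeminormedAddCommGroup T] [NormedSpace ℂ T]
    (φ : E →ₗ[ℂ] F →ₗ[ℂ] T) (r : E → A → E) (l : A → F → F) (x : E) (a : A) (y : F) :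
    φ (r x a) y - φ x (l a y) ∈ balancer φ r l :=
  Submodule.le_topologicalClosure _ (Submodule.subset_span ⟨x, a, y, rfl⟩)

section
open Classical

variable (I : Type)

theorem norm_ite_delta {Z : Type} (P : Prop) (z : Z) :
    ‖(if P then delta z else 0 : L1 Z)‖ ≤ 1 := by
  split_ifs
  · exact (norm_delta z).le
  · simp

/-- Matrix multiplication on `ℓ¹(I × I)`. -/
def mulMM : L1 (I × I) →L[ℂ] L1 (I × I) →L[ℂ] L1 (I × I) :=
  lift2 (fun p q => if p.2 = q.1 then delta (p.1, q.2) else 0) (fun _ _ => norm_ite_delta _ _)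

/-- Left action. -/
def lActM : L1 (I × I) →L[ℂ] L1 I →L[ℂ] L1 I :=
  lift2 (fun p k => if p.2 = k then delta p.1 else 0) (fun _ _ => norm_ite_delta _ _)

/-- Right action. -/
def rActM : L1 I →L[ℂ] L1 (I × I) →L[ℂ] L1 I :=
  lift2 (fun k p => if k = p.1 then delta p.2 else 0) (fun _ _ => norm_ite_delta _ _)

variable {I}

theorem mulMM_delta (p q : I × I) :
    mulMM I (delta p) (delta q) = if p.2 = q.1 then delta (p.1, q.2) else 0 := lift2_delta _ _ _ _

theorem lActM_delta (p : I × I) (k : I) :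
    lActM I (delta p) (delta k) = if p.2 = k then delta p.1 else 0 := lift2_delta _ _ _ _

theorem rActM_delta (k : I) (p : I × I) :
    rActM I (delta k) (delta p) = if k = p.1 then delta p.2 else 0 := lift2_delta _ _ _ _

theorem tsum_row (f : I × I → ℂ) (i : I) (h : ∀ p, p.1 ≠ i → f p = 0) :
    ∑' p, f p = ∑' k, f (i, k) := by
  have hi : Function.Injective (fun k : I => (i, k)) := fun a b h => by simpa using h
  refine (hi.tsum_eq (f := f) ?_).symm
  intro p hp
  by_contra hc
  refine hp (h p fun h' => hc ⟨p.2, ?_⟩)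
  rw [← h']

theorem mulMM_coord (a b : L1 (I × I)) (i j : I) :
    mulMM I a b (i, j) = ∑' k : I, a (i, k) * b (k, j) := by
  rw [mulMM, lift2_coord, tsum_row _ i]
  · refine tsum_congr fun k => ?_
    congr 1
    rw [tsum_eq_single (k, j)]
    · simp [delta_apply']
    · rintro ⟨u, w⟩ h
      by_cases hu : k = u
      · subst hu
        have : j ≠ w := fun h' => h (by rw [h'])
        simp [delta_apply', this]
      · simp [hu]
  · rintro ⟨u, w⟩ h
    have h' : ¬ i = u := fun h' => h h'.symm
    rw [mul_eq_zero]
    right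
    convert tsum_zero with q
    split_ifs <;> simp [delta_apply', h']

theorem lActM_coord (a : L1 (I × I)) (x : L1 I) (i : I) :
    lActM I a x i = ∑' k : I, a (i, k) * x k := by
  rw [lActM, lift2_coord, tsum_row _ i]
  · refine tsum_congr fun k => ?_
    congr 1
    rw [tsum_eq_single k]
    · simp [delta_apply']
    · intro u h
      simp [h.symm]
  · rintro ⟨u, w⟩ h
    have h' : ¬ i = u := fun h' => h h'.symm
    rw [mul_eq_zero]
    right
    convert tsum_zero with q
    split_ifs <;> simp [delta_apply', h']

theorem rActM_coord (x : L1 I) (a : L1 (I × I)) (i : I) :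
    rActM I x a i = ∑' k : I, x k * a (k, i) := by
  rw [rActM, lift2_coord]
  refine tsum_congr fun k => ?_
  congr 1
  rw [tsum_eq_single (k, i)]
  · simp [delta_apply']
  · rintro ⟨u, w⟩ h
    by_cases hu : k = u
    · subst hu
      have : i ≠ w := fun h' => h (by rw [h'])
      simp [delta_apply', this]
    · simp [hu]

/-- Trilinear extensionality on `ℓ¹` spaces. -/
theorem l1_ext3 {X Y Z U V W : Type}
    (f : L1 X →L[ℂ] L1 Y →L[ℂ] L1 U) (f' : L1 U →L[ℂ] L1 Z →L[ℂ] L1 W)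
    (g : L1 X →L[ℂ] L1 V →L[ℂ] L1 W) (g' : L1 Y →L[ℂ] L1 Z →L[ℂ] L1 V)
    (h : ∀ x y z, f' (f (delta x) (delta y)) (delta z) = g (delta x) (g' (delta y) (delta z)))
    (a : L1 X) (b : L1 Y) (c : L1 Z) : f' (f a b) c = g a (g' b c) := by
  have h1 : ∀ x y, f' (f (delta x) (delta y)) = (g (delta x)).comp (g' (delta y)) :=
    fun x y => l1_ext _ _ fun z => h x y z
  have h2 : ∀ x, ((f'.flip c).comp (f (delta x))) = (g (delta x)).comp (g'.flip c) :=
    fun x => l1_ext _ _ fun y => DFunLike.congr_fun (h1 x y) c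
  have h3 : (f'.flip c).comp (f.flip b) = g.flip (g' b c) :=
    l1_ext _ _ fun x => DFunLike.congr_fun (h2 x) b
  exact DFunLike.congr_fun h3 a

theorem lActM_assoc (a b : L1 (I × I)) (x : L1 I) :
    lActM I (mulMM I a b) x = lActM I a (lActM I b x) := by
  refine l1_ext3 _ _ _ _ (fun p q k => ?_) a b x
  rw [mulMM_delta, lActM_delta]
  by_cases h1 : p.2 = q.1 <;> by_cases h2 : q.2 = k <;> simp [h1, h2, lActM_delta]

theorem rActM_assoc (x : L1 I) (a b : L1 (I × I)) :
    rActM I (rActM I x a) b = rActM I x (mulMM I a b) := by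
  refine l1_ext3 _ _ _ _ (fun k p q => ?_) x a b
  rw [mulMM_delta, rActM_delta]
  by_cases h1 : p.2 = q.1 <;> by_cases h2 : k = p.1 <;> simp [h1, h2, rActM_delta]

theorem leftInducedM [Nonempty I] : LeftInduced (mulMM I) (lActM I) := by
  intro T _ _ φ hφ
  obtain ⟨o⟩ := ‹Nonempty I›
  refine induced_key φ hφ _ _ (lActM I) lActM_assoc (fun i => delta (i, o)) (fun _ => delta o)
    (fun _ => (norm_delta _).le) (fun _ => (norm_delta _).le)
    (fun i => by simp [lActM_delta]) ?_
  rintro ⟨i, j⟩ k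
  by_cases h : j = k
  · subst h
    refine Or.inl ⟨i, by simp [lActM_delta], ?_⟩
    have := balancer_mem φ (fun a b => mulMM I a b) (fun a x => lActM I a x)
      (delta (i, o)) (delta (o, j)) (delta j)
    simpa [mulMM_delta, lActM_delta] using this
  · refine Or.inr ⟨by simp [lActM_delta, h], ?_⟩
    have := balancer_mem φ (fun a b => mulMM I a b) (fun a x => lActM I a x)
      (delta (i, j)) (delta (j, j)) (delta k)
    simpa [mulMM_delta, lActM_delta, h] using this

theorem rightInducedM [Nonempty I] : RightInduced (mulMM I) (rActM I) := by
  intro T _ _ φ hφ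
  obtain ⟨o⟩ := ‹Nonempty I›
  refine induced_key φ hφ _ _ (rActM I) rActM_assoc (fun _ => delta o) (fun i => delta (o, i))
    (fun _ => (norm_delta _).le) (fun _ => (norm_delta _).le)
    (fun i => by simp [rActM_delta]) ?_
  rintro k ⟨i, j⟩
  by_cases h : k = i
  · subst h
    refine Or.inl ⟨j, by simp [rActM_delta], ?_⟩
    have := balancer_mem φ (fun x a => rActM I x a) (fun a b => mulMM I a b)
      (delta o) (delta (o, k)) (delta (k, j))
    simpa [mulMM_delta, rActM_delta] using this
  · refine Or.inr ⟨by simp [rActM_delta, h], ?_⟩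
    have := balancer_mem φ (fun x a => rActM I x a) (fun a b => mulMM I a b)
      (delta k) (delta (i, i)) (delta (i, j))
    simpa [mulMM_delta, rActM_delta, h] using this

end

/-- `ℓ¹(I)` is a two-sided `M_I`-induced module: the canonical maps
`M_I ⊗̂_{M_I} ℓ¹(I) → ℓ¹(I)`, `a ⊗ x ↦ a·x`, and `ℓ¹(I) ⊗̂_{M_I} M_I → ℓ¹(I)`,
`x ⊗ a ↦ x·a`, are topological isomorphisms. -/
theorem brandt_morita_stmt4 (I : Type) [Nonempty I] :
    ∃ (mulM : L1 (I × I) →L[ℂ] L1 (I × I) →L[ℂ] L1 (I × I))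
      (lAct : L1 (I × I) →L[ℂ] L1 I →L[ℂ] L1 I)
      (rAct : L1 I →L[ℂ] L1 (I × I) →L[ℂ] L1 I),
      (∀ (a b : L1 (I × I)) (i j : I), mulM a b (i, j) = ∑' k : I, a (i, k) * b (k, j)) ∧
      (∀ (a : L1 (I × I)) (x : L1 I) (i : I), lAct a x i = ∑' k : I, a (i, k) * x k) ∧
      (∀ (x : L1 I) (a : L1 (I × I)) (i : I), rAct x a i = ∑' k : I, x k * a (k, i)) ∧
      LeftInduced mulM lAct ∧ RightInduced mulM rAct := by
  exact ⟨mulMM I, lActM I, rActM I, mulMM_coord, lActM_coord, rActM_coord,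
    leftInducedM, rightInducedM⟩
end
end

section
/- Let G be a discrete group and I a nonempty set. Then the Banach algebra ℓ¹(B(I,G)) is self-induced and is Morita equivalent (in the sense of Grønbæk) to the Banach algebra ℓ¹(G) ⊕ ℂ with coordinatewise multiplication. -/
open scoped TensorProduct BigOperators ENNReal
open Filter

noncomputable section

/-- A witness for Morita equivalence of `(A, mulA)` and `(B, mulB)` in the sense of
Grønbæk's characterization: two-sided induced Banach bimodules `P ∈ B-mod-A` and
`Q ∈ A-mod-B` with `P ⊗̂_A Q ≅ B` and `Q ⊗̂_B P ≅ A` as bimodules. -/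
structure MoritaWitness (A B : Type) [NormedAddCommGroup A] [NormedSpace ℂ A]
    [NormedAddCommGroup B] [NormedSpace ℂ B]
    (mulA : A →L[ℂ] A →L[ℂ] A) (mulB : B →L[ℂ] B →L[ℂ] B) : Type 1 where
  P : Type
  Q : Type
  [iP1 : NormedAddCommGroup P] [iP2 : NormedSpace ℂ P] [iP3 : CompleteSpace P]
  [iQ1 : NormedAddCommGroup Q] [iQ2 : NormedSpace ℂ Q] [iQ3 : CompleteSpace Q]
  lP : B →L[ℂ] P →L[ℂ] P
  rP : P →L[ℂ] A →L[ℂ] P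
  lQ : A →L[ℂ] Q →L[ℂ] Q
  rQ : Q →L[ℂ] B →L[ℂ] Q
  lawP : IsBimoduleLaw mulB mulA lP rP
  lawQ : IsBimoduleLaw mulA mulB lQ rQ
  indPl : LeftInduced mulB lP
  indPr : RightInduced mulA rP
  indQl : LeftInduced mulA lQ
  indQr : RightInduced mulB rQ
  isoB : ∀ (T : Type) [SeminormedAddCommGroup T] [NormedSpace ℂ T]
    (φ : P →ₗ[ℂ] Q →ₗ[ℂ] T), IsProjTensor P Q T φ →
    ∃ e : (T ⧸ balancer φ (fun x a => rP x a) (fun a y => lQ a y)) ≃L[ℂ] B,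
      (∀ (b : B) (p : P) (q : Q), e (Submodule.Quotient.mk (φ (lP b p) q))
          = mulB b (e (Submodule.Quotient.mk (φ p q)))) ∧
      (∀ (b : B) (p : P) (q : Q), e (Submodule.Quotient.mk (φ p (rQ q b)))
          = mulB (e (Submodule.Quotient.mk (φ p q))) b)
  isoA : ∀ (T : Type) [SeminormedAddCommGroup T] [NormedSpace ℂ T]
    (φ : Q →ₗ[ℂ] P →ₗ[ℂ] T), IsProjTensor Q P T φ →
    ∃ e : (T ⧸ balancer φ (fun y b => rQ y b) (fun b x => lP b x)) ≃L[ℂ] A,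
      (∀ (a : A) (q : Q) (p : P), e (Submodule.Quotient.mk (φ (lQ a q) p))
          = mulA a (e (Submodule.Quotient.mk (φ q p)))) ∧
      (∀ (a : A) (q : Q) (p : P), e (Submodule.Quotient.mk (φ q (rP p a)))
          = mulA (e (Submodule.Quotient.mk (φ q p))) a)

/-- Morita equivalence of self-induced Banach algebras, via Grønbæk's
characterization. -/
def MoritaEquivalent {A B : Type} [NormedAddCommGroup A] [NormedSpace ℂ A]
    [NormedAddCommGroup B] [NormedSpace ℂ B]
    (mulA : A →L[ℂ] A →L[ℂ] A) (mulB : B →L[ℂ] B →L[ℂ] B) : Prop :=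
  Nonempty (MoritaWitness A B mulA mulB)

/-- The Brandt semigroup `B(I,G) = (I × G × I) ∪ {∘}`, with `∘ = none`. -/
abbrev Brandt (I G : Type) : Type := Option (I × G × I)

open Classical in
/-- Multiplication of the Brandt semigroup: `(i,g,j)(i',g',j') = (i,gg',j')` if
`j = i'` and `∘` otherwise; `∘` is absorbing. -/
noncomputable instance {I G : Type} [Mul G] : Mul (Brandt I G) :=
  ⟨fun a b => match a, b with
    | some (i, g, j), some (i', g', j') => if j = i' then some (i, g * g', j') else none
    | _, _ => none⟩

open Classical in
/-- The convolution product on `ℓ¹(S)` for a (semi)group `S`: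
`(a * b)(s) = ∑_{uv = s} a(u) b(v)`. -/
noncomputable def l1conv {S : Type} [Mul S] (a b : L1 S) (s : S) : ℂ :=
  ∑' p : S × S, if p.1 * p.2 = s then a p.1 * b p.2 else 0

namespace BrandtAux

theorem norm_delta {X : Type} (x : X) : ‖delta x‖ = 1 := by
  simp [delta, lp.norm_single]

theorem delta_self {X : Type} (x : X) : delta x x = 1 := by
  simp [delta]

theorem delta_ne {X : Type} {x y : X} (h : x ≠ y) : delta x y = 0 := by
  classical
  exact lp.single_apply_ne _ _ _ (Ne.symm h)

theorem hasSum_of_eq {X : Type} {f g : X → ℂ} {c : ℂ} (h : ∀ x, f x = g x)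
    (hg : HasSum g c) : HasSum f c := by
  rwa [funext h]

theorem hasSum_delta {X : Type} (f : L1 X) : HasSum (fun x => f x • delta x) f := by
  classical
  have h := lp.hasSum_single (p := 1) (by simp) f
  convert h using 2 with x
  rw [delta, ← lp.single_smul]
  simp

theorem hasSum_norm {X : Type} (f : L1 X) : HasSum (fun x => ‖f x‖) ‖f‖ := by
  have h := lp.hasSum_norm (p := 1) (by simp) f
  simpa using h

theorem ext_delta {X V : Type} [NormedAddCommGroup V] [NormedSpace ℂ V]
    {S T : L1 X →L[ℂ] V} (h : ∀ x, S (delta x) = T (delta x)) : S = T := by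
  ext f
  have h1 := (hasSum_delta f).mapL S
  have h2 := (hasSum_delta f).mapL T
  simp only [map_smul, h] at h1 h2
  exact h1.unique h2

theorem summable_lift {X V : Type} [NormedAddCommGroup V] [NormedSpace ℂ V] [CompleteSpace V]
    (v : X → V) (hv : ∃ C, ∀ x, ‖v x‖ ≤ C) (f : L1 X) : Summable (fun x => f x • v x) := by
  obtain ⟨C, hC⟩ := hv
  refine Summable.of_norm_bounded ((hasSum_norm f).summable.mul_right C) fun x => ?_
  rw [norm_smul]
  exact mul_le_mul_of_nonneg_left (hC x) (norm_nonneg _)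

/-- Extension of a bounded family to a bounded operator on `ℓ¹`. -/
def l1lift {X V : Type} [NormedAddCommGroup V] [NormedSpace ℂ V] [CompleteSpace V]
    (v : X → V) (hv : ∃ C, ∀ x, ‖v x‖ ≤ C) : L1 X →L[ℂ] V :=
  LinearMap.mkContinuousOfExistsBound
    { toFun := fun f => ∑' x, f x • v x
      map_add' := fun f g => by
        rw [← (summable_lift v hv f).tsum_add (summable_lift v hv g)]
        simp [add_smul]
      map_smul' := fun c f => by
        rw [RingHom.id_apply, ← (summable_lift v hv f).tsum_const_smul]
        simp [mul_smul] }
    (by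
      obtain ⟨C, hC⟩ := hv
      refine ⟨C, fun f => ?_⟩
      have h := (hasSum_norm f).mul_right C
      rw [mul_comm]
      refine tsum_of_norm_bounded h fun x => ?_
      rw [norm_smul]
      exact mul_le_mul_of_nonneg_left (hC x) (norm_nonneg _))

theorem l1lift_apply {X V : Type} [NormedAddCommGroup V] [NormedSpace ℂ V] [CompleteSpace V]
    (v : X → V) (hv : ∃ C, ∀ x, ‖v x‖ ≤ C) (f : L1 X) : l1lift v hv f = ∑' x, f x • v x := rfl

theorem l1lift_norm {X V : Type} [NormedAddCommGroup V] [NormedSpace ℂ V] [CompleteSpace V]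
    (v : X → V) (C : ℝ) (hC : ∀ x, ‖v x‖ ≤ C) (h0 : 0 ≤ C) : ‖l1lift v ⟨C, hC⟩‖ ≤ C := by
  refine ContinuousLinearMap.opNorm_le_bound _ h0 fun f => ?_
  have h := (hasSum_norm f).mul_right C
  rw [mul_comm]
  refine tsum_of_norm_bounded h fun x => ?_
  rw [norm_smul]
  exact mul_le_mul_of_nonneg_left (hC x) (norm_nonneg _)

@[simp]
theorem l1lift_delta {X V : Type} [NormedAddCommGroup V] [NormedSpace ℂ V] [CompleteSpace V]
    (v : X → V) (hv : ∃ C, ∀ x, ‖v x‖ ≤ C) (x : X) : l1lift v hv (delta x) = v x := by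
  classical
  rw [l1lift_apply, tsum_eq_single x]
  · simp [delta]
  · intro y hy
    rw [delta, lp.single_apply_ne _ _ _ hy, zero_smul]

/-- Bilinear extension of a bounded family. -/
def l1lift2 {X Y V : Type} [NormedAddCommGroup V] [NormedSpace ℂ V] [CompleteSpace V]
    (v : X → Y → V) (hv : ∀ x y, ‖v x y‖ ≤ 1) : L1 X →L[ℂ] L1 Y →L[ℂ] V :=
  l1lift (fun x => l1lift (v x) ⟨1, hv x⟩) ⟨1, fun x => l1lift_norm _ _ (hv x) zero_le_one⟩

@[simp]
theorem l1lift2_delta {X Y V : Type} [NormedAddCommGroup V] [NormedSpace ℂ V] [CompleteSpace V]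
    (v : X → Y → V) (hv : ∀ x y, ‖v x y‖ ≤ 1) (x : X) (y : Y) :
    l1lift2 v hv (delta x) (delta y) = v x y := by
  simp [l1lift2]

theorem ext_delta2 {X Y V : Type} [NormedAddCommGroup V] [NormedSpace ℂ V]
    {S T : L1 X →L[ℂ] L1 Y →L[ℂ] V}
    (h : ∀ x y, S (delta x) (delta y) = T (delta x) (delta y)) : S = T :=
  ext_delta fun x => ext_delta fun y => h x y

/-- Convolution on `ℓ¹(S)`. -/
def conv (S : Type) [Mul S] : L1 S →L[ℂ] L1 S →L[ℂ] L1 S :=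
  l1lift2 (fun s t => delta (s * t)) (fun _ _ => (norm_delta _).le)

theorem conv_apply {S : Type} [Mul S] (a b : L1 S) (s : S) : conv S a b s = l1conv a b s := by
  classical
  -- evaluation at `s` is continuous
  let ev : L1 S →L[ℂ] ℂ := lp.evalCLM ℂ (fun _ : S => ℂ) 1 s
  have hev : ∀ f : L1 S, ev f = f s := fun f => rfl
  have ha := (hasSum_delta a).mapL ((conv S).flip b)
  have key : ∀ u, HasSum (fun v => if u * v = s then a u * b v else 0)
      (ev ((conv S).flip b (a u • delta u))) := by
    intro u
    have hb := (hasSum_delta b).mapL (ev.comp ((conv S) (a u • delta u)))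
    refine hasSum_of_eq ?_ hb
    intro v
    simp only [map_smul, ContinuousLinearMap.comp_apply, _root_.smul_apply, conv,
      l1lift2_delta, smul_eq_mul]
    rw [hev]
    by_cases h : u * v = s
    · subst h
      rw [delta_self]
      simp [mul_comm]
    · rw [if_neg h, delta_ne h]
      simp
  have hs : Summable (fun p : S × S => if p.1 * p.2 = s then a p.1 * b p.2 else 0) := by
    have h1 : Summable (fun p : S × S => ‖a p.1‖ * ‖b p.2‖) :=
      (hasSum_norm a).summable.mul_of_nonneg (hasSum_norm b).summable
        (fun _ => norm_nonneg _) (fun _ => norm_nonneg _)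
    refine Summable.of_norm_bounded h1 fun p => ?_
    split_ifs
    · simp
    · simp; positivity
  rw [l1conv, ← hev]
  have h3 := HasSum.prod_fiberwise hs.hasSum key
  have h4 := ha.mapL ev
  have h5 := h4.unique h3
  exact h5

theorem projNorm_bound {E F M : Type} [SeminormedAddCommGroup E] [NormedSpace ℂ E]
    [SeminormedAddCommGroup F] [NormedSpace ℂ F] [NormedAddCommGroup M] [NormedSpace ℂ M]
    (β : E →L[ℂ] F →L[ℂ] M) (b : E →ₗ[ℂ] F →ₗ[ℂ] M) (hb : ∀ x y, b x y = β x y)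
    (z : E ⊗[ℂ] F) : ‖TensorProduct.lift b z‖ ≤ ‖β‖ * projNorm z := by
  have hne : {r : ℝ | ∃ (n : ℕ) (x : Fin n → E) (y : Fin n → F),
      z = ∑ i, x i ⊗ₜ[ℂ] y i ∧ r = ∑ i, ‖x i‖ * ‖y i‖}.Nonempty := by
    induction z using TensorProduct.induction_on with
    | zero => exact ⟨_, 0, Fin.elim0, Fin.elim0, by simp, rfl⟩
    | tmul x y => exact ⟨_, 1, fun _ => x, fun _ => y, by simp, rfl⟩
    | add u v hu hv =>
      obtain ⟨_, n, x, y, h, -⟩ := hu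
      obtain ⟨_, m, x', y', h', -⟩ := hv
      refine ⟨_, n + m, Fin.append x x', Fin.append y y', ?_, rfl⟩
      rw [Fin.sum_univ_add]
      simp [h, h']
  have hle : ∀ r ∈ {r : ℝ | ∃ (n : ℕ) (x : Fin n → E) (y : Fin n → F),
      z = ∑ i, x i ⊗ₜ[ℂ] y i ∧ r = ∑ i, ‖x i‖ * ‖y i‖}, ‖TensorProduct.lift b z‖ ≤ ‖β‖ * r := by
    rintro r ⟨n, x, y, rfl, rfl⟩
    rw [map_sum, Finset.mul_sum]
    refine norm_sum_le_of_le _ fun i _ => ?_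
    rw [TensorProduct.lift.tmul, hb, ← mul_assoc]
    exact β.le_opNorm₂ _ _
  rcases (norm_nonneg β).eq_or_lt with h0 | h0
  · obtain ⟨r, hr⟩ := hne
    have := hle r hr
    rw [← h0] at this ⊢
    simpa using this
  · rw [← div_le_iff₀' h0]
    refine le_csInf hne fun r hr => ?_
    rw [div_le_iff₀' h0]
    exact hle r hr

theorem phi_norm_le {E F T : Type} [SeminormedAddCommGroup E] [NormedSpace ℂ E]
    [SeminormedAddCommGroup F] [NormedSpace ℂ F]
    [SeminormedAddCommGroup T] [NormedSpace ℂ T]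
    {φ : E →ₗ[ℂ] F →ₗ[ℂ] T} (h : IsProjTensor E F T φ) (x : E) (y : F) :
    ‖φ x y‖ ≤ ‖x‖ * ‖y‖ := by
  rw [← TensorProduct.lift.tmul, h.isometry]
  refine csInf_le ⟨0, ?_⟩ ⟨1, fun _ => x, fun _ => y, by simp, by simp⟩
  rintro r ⟨n, x, y, -, rfl⟩
  exact Finset.sum_nonneg fun i _ => by positivity

/-- Criterion for `E ⊗̂_C F ≅ M`. -/
theorem iso_of_section {C E F M T : Type} [NormedAddCommGroup E] [NormedSpace ℂ E]
    [NormedAddCommGroup F] [NormedSpace ℂ F] [NormedAddCommGroup M] [NormedSpace ℂ M]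
    [CompleteSpace M] [SeminormedAddCommGroup T] [NormedSpace ℂ T]
    (φ : E →ₗ[ℂ] F →ₗ[ℂ] T) (h : IsProjTensor E F T φ) (r : E → C → E) (l : C → F → F)
    (β : E →L[ℂ] F →L[ℂ] M) (hβ : ∀ x c y, β (r x c) y = β x (l c y))
    (s : M →L[ℂ] T ⧸ balancer φ r l)
    (hs : ∀ x y, s (β x y) = Submodule.Quotient.mk (φ x y))
    (hd : Dense (Submodule.span ℂ {m : M | ∃ x y, m = β x y} : Set M)) :
    ∃ e : (T ⧸ balancer φ r l) ≃L[ℂ] M, ∀ x y, e (Submodule.Quotient.mk (φ x y)) = β x y := by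
  have := h.complete
  have hcl : IsClosed (balancer φ r l : Set T) := Submodule.isClosed_topologicalClosure _
  let b : E →ₗ[ℂ] F →ₗ[ℂ] M := LinearMap.mk₂ ℂ (fun x y => β x y) (by simp) (by simp)
    (by simp) (by simp)
  let B : T →L[ℂ] M := (TensorProduct.lift b).extendOfNorm (TensorProduct.lift φ)
  have hB : ∀ x y, B (φ x y) = β x y := by
    intro x y
    have := LinearMap.extendOfNorm_eq (f := TensorProduct.lift b) (e := TensorProduct.lift φ)
      h.dense ⟨‖β‖, fun z => by rw [h.isometry]; exact projNorm_bound β b (fun _ _ => rfl) z⟩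
      (x ⊗ₜ y)
    rw [TensorProduct.lift.tmul, TensorProduct.lift.tmul] at this
    exact this
  have hker : balancer φ r l ≤ B.ker := by
    refine Submodule.topologicalClosure_minimal _ ?_ B.isClosed_ker
    rw [Submodule.span_le]
    rintro _ ⟨x, a, y, rfl⟩
    simp [hB, hβ]
  let Bq : (T ⧸ balancer φ r l) →L[ℂ] M := (balancer φ r l).liftQL B hker
  have hBq : ∀ t : T, Bq (Submodule.Quotient.mk t) = B t := fun t => rfl
  refine ⟨ContinuousLinearEquiv.equivOfInverse Bq s ?_ ?_, fun x y => ?_⟩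
  · intro q
    obtain ⟨t, rfl⟩ := Submodule.Quotient.mk_surjective _ q
    have h1 : (fun t : T => s (Bq ((balancer φ r l).mkQL t))) = fun t => (balancer φ r l).mkQL t := by
      refine h.dense.equalizer (by fun_prop) (by fun_prop) ?_
      funext z
      induction z using TensorProduct.induction_on with
      | zero => simp
      | tmul x y =>
        simp only [Function.comp, TensorProduct.lift.tmul]
        exact (congrArg s ((hBq _).trans (hB x y))).trans (hs x y)
      | add u v hu hv =>
        simp only [Function.comp, map_add] at hu hv ⊢
        rw [hu, hv]
    exact congrFun h1 t
  · intro m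
    have : (Bq.comp s) = ContinuousLinearMap.id ℂ M := by
      refine ContinuousLinearMap.ext_on hd ?_
      rintro _ ⟨x, y, rfl⟩
      simp only [ContinuousLinearMap.comp_apply, hs, hBq, hB]
      rfl
    exact congrArg (fun f => f m) this
  · exact (hBq _).trans (hB x y)

set_option linter.unusedSimpArgs false
open Classical in
/-- Product of basis elements in the (contracted) linking groupoid. -/
def pm {J K L G : Type} [Mul G] :
    Option (J × G × K) → Option (K × G × L) → L1 (Option (J × G × L))
  | none, none => delta none
  | some (j, g, k), some (k', g', l) => if k = k' then delta (some (j, g * g', l)) else 0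
  | none, some _ => 0
  | some _, none => 0

theorem pm_norm {J K L G : Type} [Mul G] (x : Option (J × G × K)) (y : Option (K × G × L)) :
    ‖pm x y‖ ≤ 1 := by
  rcases x with _ | ⟨j, g, k⟩ <;> rcases y with _ | ⟨k', g', l⟩ <;> simp only [pm]
  · exact (norm_delta _).le
  · simp
  · simp
  · split_ifs
    · exact (norm_delta _).le
    · simp

/-- Multiplication of rectangular matrices over `ℓ¹(G)`, plus a scalar. -/
def gm (J K L G : Type) [Mul G] :
    L1 (Option (J × G × K)) →L[ℂ] L1 (Option (K × G × L)) →L[ℂ] L1 (Option (J × G × L)) :=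
  l1lift2 pm pm_norm

theorem gm_nn {J K L G : Type} [Mul G] : gm J K L G (delta none) (delta none) = delta none := by
  simp [gm, pm]

theorem gm_ns {J K L G : Type} [Mul G] (y) : gm J K L G (delta none) (delta (some y)) = 0 := by
  simp [gm, pm]

theorem gm_sn {J K L G : Type} [Mul G] (y) : gm J K L G (delta (some y)) (delta none) = 0 := by
  simp [gm, pm]

theorem gm_ss {J K L G : Type} [Mul G] (j k l) (g g' : G) :
    gm J K L G (delta (some (j, g, k))) (delta (some (k, g', l))) =
      delta (some (j, g * g', l)) := by
  simp [gm, pm]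

theorem gm_ss_ne {J K L G : Type} [Mul G] (j k k' l) (g g' : G) (h : k ≠ k') :
    gm J K L G (delta (some (j, g, k))) (delta (some (k', g', l))) = 0 := by
  simp [gm, pm, h]

theorem gm_assoc {J K L M G : Type} [Group G] (x : L1 (Option (J × G × K)))
    (y : L1 (Option (K × G × L))) (z : L1 (Option (L × G × M))) :
    gm J L M G (gm J K L G x y) z = gm J K M G x (gm K L M G y z) := by
  have key : ∀ x y, (gm J L M G (gm J K L G (delta x) (delta y))) =
      (gm J K M G (delta x)).comp (gm K L M G (delta y)) := by
    intro x y
    refine ext_delta fun z => ?_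
    rw [ContinuousLinearMap.comp_apply]
    rcases x with _ | ⟨j, g, k⟩ <;> rcases y with _ | ⟨k', g', l⟩ <;>
      rcases z with _ | ⟨l', g'', m⟩
    · simp [gm_nn, gm_ns, gm_sn]
    · simp [gm_nn, gm_ns, gm_sn]
    · simp [gm_nn, gm_ns, gm_sn]
    · by_cases h : l = l'
      · subst h
        simp [gm_nn, gm_ns, gm_sn, gm_ss]
      · simp [gm_nn, gm_ns, gm_sn, gm_ss_ne _ _ _ _ _ _ h]
    · simp [gm_nn, gm_ns, gm_sn]
    · simp [gm_nn, gm_ns, gm_sn]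
    · by_cases h : k = k'
      · subst h
        simp [gm_nn, gm_ns, gm_sn, gm_ss]
      · simp [gm_nn, gm_ns, gm_sn, gm_ss_ne _ _ _ _ _ _ h]
    · by_cases h : k = k' <;> by_cases h' : l = l'
      · subst h h'
        simp [gm_ss, mul_assoc]
      · subst h
        simp [gm_ss, gm_ss_ne _ _ _ _ _ _ h']
      · subst h'
        simp [gm_ss, gm_ss_ne _ _ _ _ _ _ h]
      · simp [gm_ss_ne _ _ _ _ _ _ h', gm_ss_ne _ _ _ _ _ _ h]
  have e1 : ((gm J L M G).flip z).comp ((gm J K L G).flip y) =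
      (gm J K M G).flip (gm K L M G y z) := by
    refine ext_delta fun x => ?_
    have e2 : ((gm J L M G).flip z).comp (gm J K L G (delta x)) =
        (gm J K M G (delta x)).comp ((gm K L M G).flip z) := by
      refine ext_delta fun y => ?_
      exact congrArg (fun f => f z) (key x y)
    exact congrArg (fun f => f y) e2
  exact congrArg (fun f => f x) e1

theorem gm_iso {J K L G : Type} [Group G] [Nonempty K] {C E F M : Type}
    [NormedAddCommGroup E] [NormedSpace ℂ E]
    [NormedAddCommGroup F] [NormedSpace ℂ F] [NormedAddCommGroup M] [NormedSpace ℂ M]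
    [CompleteSpace M] [NormedAddCommGroup C] [NormedSpace ℂ C]
    (eE : E ≃L[ℂ] L1 (Option (J × G × K))) (eF : F ≃L[ℂ] L1 (Option (K × G × L)))
    (eM : M ≃L[ℂ] L1 (Option (J × G × L))) (eC : C ≃L[ℂ] L1 (Option (K × G × K)))
    (r : E → C → E) (l : C → F → F) (β : E →L[ℂ] F →L[ℂ] M)
    (hr : ∀ x c, eE (r x c) = gm J K K G (eE x) (eC c))
    (hl : ∀ c y, eF (l c y) = gm K K L G (eC c) (eF y))
    (hβ : ∀ x y, eM (β x y) = gm J K L G (eE x) (eF y))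
    (T : Type) [SeminormedAddCommGroup T] [NormedSpace ℂ T]
    (φ : E →ₗ[ℂ] F →ₗ[ℂ] T) (h : IsProjTensor E F T φ) :
    ∃ e : (T ⧸ balancer φ r l) ≃L[ℂ] M, ∀ x y, e (Submodule.Quotient.mk (φ x y)) = β x y := by
  classical
  have := h.complete
  have hcl : IsClosed (balancer φ r l : Set T) := Submodule.isClosed_topologicalClosure _
  obtain ⟨k0⟩ := ‹Nonempty K›
  -- the continuous bilinear map to the quotient
  let ψ : E →L[ℂ] F →L[ℂ] T ⧸ balancer φ r l :=
    LinearMap.mkContinuous₂ (φ.compr₂ (balancer φ r l).mkQ) 1 (fun x y => by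
      rw [one_mul]
      exact (Submodule.Quotient.norm_mk_le _ _).trans (phi_norm_le h x y))
  have hψ : ∀ x y, ψ x y = Submodule.Quotient.mk (φ x y) := fun x y => rfl
  have hbal : ∀ x c y, ψ (r x c) y = ψ x (l c y) := by
    intro x c y
    rw [hψ, hψ, Submodule.Quotient.eq]
    exact Submodule.le_topologicalClosure _ (Submodule.subset_span ⟨x, c, y, rfl⟩)
  let Ψ : L1 (Option (J × G × K)) →L[ℂ] L1 (Option (K × G × L)) →L[ℂ] T ⧸ balancer φ r l :=
    ψ.bilinearComp (eE.symm : _ →L[ℂ] E) (eF.symm : _ →L[ℂ] F)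
  have hΨ : ∀ x y, Ψ (eE x) (eF y) = ψ x y := by
    intro x y
    simp [Ψ]
  have hΨb : ∀ x c y, Ψ (gm J K K G x c) y = Ψ x (gm K K L G c y) := by
    intro x c y
    have h1 := hr (eE.symm x) (eC.symm c)
    have h2 := hl (eC.symm c) (eF.symm y)
    have h3 := hbal (eE.symm x) (eC.symm c) (eF.symm y)
    simp only [ContinuousLinearEquiv.apply_symm_apply] at h1 h2
    rw [← h1, ← h2]
    rw [← hΨ, ← hΨ] at h3
    simpa using h3
  let v : Option (J × G × L) → T ⧸ balancer φ r l := fun z => match z with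
    | none => Ψ (delta none) (delta none)
    | some (j, g, l) => Ψ (delta (some (j, g, k0))) (delta (some (k0, 1, l)))
  have hv : ∃ C, ∀ z, ‖v z‖ ≤ C := by
    have hb : ∀ x y, ‖Ψ (delta x) (delta y)‖ ≤
        ‖(eE.symm : L1 (Option (J × G × K)) →L[ℂ] E)‖ * ‖(eF.symm : L1 (Option (K × G × L)) →L[ℂ] F)‖ := by
      intro x y
      have h1 := (eE.symm : L1 (Option (J × G × K)) →L[ℂ] E).le_opNorm (delta x)
      have h2 := (eF.symm : L1 (Option (K × G × L)) →L[ℂ] F).le_opNorm (delta y)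
      rw [norm_delta, mul_one] at h1 h2
      exact ((Submodule.Quotient.norm_mk_le _ _).trans (phi_norm_le h _ _)).trans
        (mul_le_mul h1 h2 (norm_nonneg _) (norm_nonneg _))
    refine ⟨‖(eE.symm : L1 (Option (J × G × K)) →L[ℂ] E)‖ *
      ‖(eF.symm : L1 (Option (K × G × L)) →L[ℂ] F)‖, fun z => ?_⟩
    rcases z with _ | ⟨j, g, l⟩
    · exact hb _ _
    · exact hb _ _
  let s0 := l1lift v hv
  have hs0 : (ContinuousLinearMap.compL ℂ _ _ _ s0).comp (gm J K L G) = Ψ := by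
    refine ext_delta2 fun x y => ?_
    change s0 (gm J K L G (delta x) (delta y)) = _
    rcases x with _ | ⟨j, g, k⟩ <;> rcases y with _ | ⟨k', g', l⟩
    · simp [gm_nn, s0, v]
    · have h1 := hΨb (delta none) (delta (some (k', 1, k'))) (delta (some (k', g', l)))
      rw [gm_ss, gm_ns, one_mul] at h1
      rw [← h1, gm_ns]
      simp
    · have h1 := hΨb (delta (some (j, g, k))) (delta none) (delta none)
      rw [gm_nn, gm_sn] at h1
      rw [← h1, gm_sn]
      simp
    · by_cases hk : k = k'
      · subst hk
        have h1 := hΨb (delta (some (j, g, k))) (delta (some (k, g', k0)))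
          (delta (some (k0, 1, l)))
        rw [gm_ss, gm_ss, mul_one] at h1
        rw [← h1, gm_ss]
        simp [s0, v]
      · have h1 := hΨb (delta (some (j, g, k))) (delta (some (k', 1, k')))
          (delta (some (k', g', l)))
        rw [gm_ss, gm_ss_ne _ _ _ _ _ _ hk, one_mul] at h1
        rw [← h1, gm_ss_ne _ _ _ _ _ _ hk]
        simp
  refine iso_of_section φ h r l β ?_ (s0.comp (eM : M →L[ℂ] _)) ?_ ?_
  · intro x c y
    apply eM.injective
    rw [hβ, hβ, hr, hl, gm_assoc]
  · intro x y
    rw [← hψ, ← hΨ, ← hs0]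
    change s0 (eM (β x y)) = s0 (gm J K L G (eE x) (eF y))
    rw [hβ]
  · -- density
    have hmem : ∀ z, eM.symm (delta z) ∈ Submodule.span ℂ {m : M | ∃ x y, m = β x y} := by
      intro z
      apply Submodule.subset_span
      rcases z with _ | ⟨j, g, l⟩
      · refine ⟨eE.symm (delta none), eF.symm (delta none), ?_⟩
        rw [ContinuousLinearEquiv.symm_apply_eq, hβ]
        simp [gm_nn]
      · refine ⟨eE.symm (delta (some (j, g, k0))), eF.symm (delta (some (k0, 1, l))), ?_⟩
        rw [ContinuousLinearEquiv.symm_apply_eq, hβ]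
        simp [gm_ss]
    intro m
    have h1 := (hasSum_delta (eM m)).mapL (eM.symm : _ →L[ℂ] M)
    simp only [ContinuousLinearEquiv.coe_coe, ContinuousLinearEquiv.symm_apply_apply] at h1
    refine mem_closure_of_tendsto h1 (Eventually.of_forall fun t => ?_)
    refine Submodule.sum_mem _ fun z _ => ?_
    rw [map_smul]
    exact Submodule.smul_mem _ _ (hmem z)

theorem brandt_none_mul {I G : Type} [Mul G] (x : Brandt I G) : (none : Brandt I G) * x = none := by
  rfl

theorem brandt_mul_none {I G : Type} [Mul G] (x : Brandt I G) : x * (none : Brandt I G) = none := by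
  rcases x with _ | ⟨i, g, j⟩ <;> rfl

theorem brandt_mul {I G : Type} [Mul G] (i j l : I) (g h : G) :
    (some (i, g, j) : Brandt I G) * (some (j, h, l) : Brandt I G) = some (i, g * h, l) := by
  classical
  change (if j = j then _ else _) = _
  simp

theorem brandt_mul_ne {I G : Type} [Mul G] (i j k l : I) (g h : G) (hjk : j ≠ k) :
    (some (i, g, j) : Brandt I G) * (some (k, h, l) : Brandt I G) = none := by
  classical
  change (if j = k then _ else _) = _
  simp [hjk]

theorem conv_delta {S : Type} [Mul S] (s t : S) : conv S (delta s) (delta t) = delta (s * t) := by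
  simp [conv]

/-- Change of basis `δ_x ↦ δ_x + c δ_∘` on `ℓ¹(S)`. -/
def shift (X : Type) (c : ℂ) : L1 (Option X) →L[ℂ] L1 (Option X) :=
  l1lift (fun z => match z with
    | none => delta none
    | some x => delta (some x) + c • delta none)
    ⟨1 + ‖c‖, fun z => by
      rcases z with _ | x
      · simp [norm_delta]
      · refine (norm_add_le _ _).trans ?_
        simp [norm_smul, norm_delta]⟩

theorem shift_none (X : Type) (c : ℂ) : shift X c (delta none) = delta none := by
  simp [shift]

theorem shift_some (X : Type) (c : ℂ) (x : X) :
    shift X c (delta (some x)) = delta (some x) + c • delta none := by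
  simp [shift]

theorem shift_shift (X : Type) (c d : ℂ) (h : c + d = 0) (f : L1 (Option X)) :
    shift X c (shift X d f) = f := by
  have : (shift X c).comp (shift X d) = ContinuousLinearMap.id ℂ _ := by
    refine ext_delta fun z => ?_
    rcases z with _ | x
    · simp [shift_none]
    · simp only [ContinuousLinearMap.comp_apply, shift_some, map_add, map_smul, shift_none,
        add_assoc, ← add_smul, h]
      simp
  exact congrArg (fun u => u f) this

/-- `ℓ¹(B(I,G)) ≅ M_I(ℓ¹(G)) ⊕ ℂ`. -/
def eA (I G : Type) : L1 (Brandt I G) ≃L[ℂ] L1 (Option (I × G × I)) :=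
  ContinuousLinearEquiv.equivOfInverse (shift _ 1) (shift _ (-1))
    (shift_shift _ _ _ (by simp)) (shift_shift _ _ _ (by simp))

theorem eA_none (I G : Type) : eA I G (delta none) = delta none := shift_none _ _

theorem eA_some (I G : Type) (x) : eA I G (delta (some x)) = delta (some x) + delta none := by
  have := shift_some (I × G × I) 1 x
  rw [one_smul] at this
  exact this

theorem eA_mul (I G : Type) [Mul G] (a b : L1 (Brandt I G)) :
    eA I G (conv (Brandt I G) a b) = gm I I I G (eA I G a) (eA I G b) := by
  have : (ContinuousLinearMap.compL ℂ _ _ _ (eA I G : _ →L[ℂ] L1 (Option (I × G × I)))).comp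
      (conv (Brandt I G)) = (gm I I I G).bilinearComp (eA I G : _ →L[ℂ] L1 (Option (I × G × I)))
        (eA I G : _ →L[ℂ] L1 (Option (I × G × I))) := by
    refine ext_delta2 fun x y => ?_
    change eA I G (conv (Brandt I G) (delta x) (delta y)) =
      gm I I I G (eA I G (delta x)) (eA I G (delta y))
    rw [conv_delta]
    rcases x with _ | ⟨j, g, k⟩ <;> rcases y with _ | ⟨k', g', l⟩
    · simp [brandt_none_mul, eA_none, gm_nn]
    · simp [brandt_none_mul, eA_none, eA_some, gm_nn, gm_ns]
    · simp [brandt_mul_none, eA_none, eA_some, gm_nn, gm_sn]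
    · by_cases h : k = k'
      · subst h
        simp [brandt_mul, eA_some, gm_nn, gm_ns, gm_sn, gm_ss]
      · simp [brandt_mul_ne _ _ _ _ _ _ h, eA_none, eA_some, gm_nn, gm_ns, gm_sn,
          gm_ss_ne _ _ _ _ _ _ h]
  exact congrArg (fun u => u a b) this

/-- The forward map `ℓ¹(G) ⊕ ℂ → ℓ¹(Option (1 × G × 1))`. -/
def eBf (G : Type) : (L1 G × ℂ) →L[ℂ] L1 (Option (Unit × G × Unit)) :=
  (l1lift (fun g => delta (some ((), g, ()))) ⟨1, fun _ => (norm_delta _).le⟩).coprod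
    ((ContinuousLinearMap.id ℂ ℂ).smulRight (delta none))

theorem eBf_delta (G : Type) (g : G) (c : ℂ) :
    eBf G (delta g, c) = delta (some ((), g, ())) + c • delta none := by
  simp [eBf]

/-- The inverse map. -/
def eBi (G : Type) : L1 (Option (Unit × G × Unit)) →L[ℂ] (L1 G × ℂ) :=
  l1lift (fun z => match z with
    | none => (0, 1)
    | some (_, g, _) => (delta g, 0)) ⟨1, fun z => by
      rcases z with _ | ⟨_, g, _⟩
      · simp [Prod.norm_def]
      · simp [Prod.norm_def, norm_delta]⟩

/-- `ℓ¹(G) ⊕ ℂ ≅ ℓ¹(Option (1 × G × 1))`. -/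
def eB (G : Type) : (L1 G × ℂ) ≃L[ℂ] L1 (Option (Unit × G × Unit)) :=
  ContinuousLinearEquiv.equivOfInverse (eBf G) (eBi G)
    (by
      rintro ⟨f, c⟩
      have h1 : ((eBi G).comp (eBf G)).comp (ContinuousLinearMap.inl ℂ (L1 G) ℂ) =
          ContinuousLinearMap.inl ℂ (L1 G) ℂ := by
        refine ext_delta fun g => ?_
        simp [eBf_delta, eBi]
      have h2 := congrArg (fun u => u f) h1
      have h3 : eBi G (eBf G (0, c)) = (0, c) := by
        simp [eBf, eBi]
      have h4 : ((f, c) : L1 G × ℂ) = (f, 0) + (0, c) := by simp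
      rw [h4, map_add, map_add, h3]
      exact congrArg (· + ((0, c) : L1 G × ℂ)) h2)
    (by
      intro f
      have h1 : (eBf G).comp (eBi G) = ContinuousLinearMap.id ℂ _ := by
        refine ext_delta fun z => ?_
        rcases z with _ | ⟨_, g, _⟩
        · simp [eBf, eBi]
        · simp [eBf, eBi]
      exact congrArg (fun u => u f) h1)

theorem eB_mul (G : Type) [Mul G] (p q : L1 G × ℂ) :
    eB G (conv G p.1 q.1, p.2 * q.2) = gm Unit Unit Unit G (eB G p) (eB G q) := by
  let ι : L1 G →L[ℂ] L1 (Option (Unit × G × Unit)) :=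
    l1lift (fun g => delta (some ((), g, ()))) ⟨1, fun _ => (norm_delta _).le⟩
  have hι : ∀ g, ι (delta g) = delta (some ((), g, ())) := fun g => by simp [ι]
  have he : ∀ f c, eB G (f, c) = ι f + c • delta none := fun f c => by
    change eBf G (f, c) = _
    simp [eBf, ι]
  have h1 : (ContinuousLinearMap.compL ℂ _ _ _ ι).comp (conv G) =
      (gm Unit Unit Unit G).bilinearComp ι ι := by
    refine ext_delta2 fun x y => ?_
    change ι (conv G (delta x) (delta y)) = gm Unit Unit Unit G (ι (delta x)) (ι (delta y))
    rw [conv_delta, hι, hι, hι, gm_ss]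
  have h2 : ∀ f, gm Unit Unit Unit G (ι f) (delta none) = 0 := by
    intro f
    have : ((gm Unit Unit Unit G).flip (delta none)).comp ι = 0 := by
      refine ext_delta fun x => ?_
      simp [hι, gm_sn]
    exact congrArg (fun u => u f) this
  have h3 : ∀ f, gm Unit Unit Unit G (delta none) (ι f) = 0 := by
    intro f
    have : (gm Unit Unit Unit G (delta none)).comp ι = 0 := by
      refine ext_delta fun x => ?_
      simp [hι, gm_ns]
    exact congrArg (fun u => u f) this
  obtain ⟨f, c⟩ := p
  obtain ⟨f', c'⟩ := q
  have h4 : ι (conv G f f') = gm Unit Unit Unit G (ι f) (ι f') :=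
    congrArg (fun u => u f f') h1
  rw [he, he, he, h4]
  simp [h2, h3, gm_nn, mul_smul]
  try rw [smul_comm]

/-- Multiplication on `ℓ¹(G) ⊕ ℂ`. -/
def mulB (G : Type) [Mul G] : (L1 G × ℂ) →L[ℂ] (L1 G × ℂ) →L[ℂ] (L1 G × ℂ) :=
  (ContinuousLinearMap.compL ℂ _ _ _ ((eB G).symm : _ →L[ℂ] L1 G × ℂ)).comp
    ((gm Unit Unit Unit G).bilinearComp (eB G : _ →L[ℂ] L1 (Option (Unit × G × Unit)))
      (eB G : _ →L[ℂ] L1 (Option (Unit × G × Unit))))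

theorem mulB_eB (G : Type) [Mul G] (p q : L1 G × ℂ) :
    eB G (mulB G p q) = gm Unit Unit Unit G (eB G p) (eB G q) := by
  change eB G ((eB G).symm _) = _
  rw [ContinuousLinearEquiv.apply_symm_apply]
  rfl

theorem mulB_apply (G : Type) [Mul G] (p q : L1 G × ℂ) :
    mulB G p q = (conv G p.1 q.1, p.2 * q.2) := by
  apply (eB G).injective
  rw [mulB_eB, eB_mul]

/-- Left action on `P`. -/
def lP (I G : Type) [Mul G] :
    (L1 G × ℂ) →L[ℂ] L1 (Option (Unit × G × I)) →L[ℂ] L1 (Option (Unit × G × I)) :=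
  (gm Unit Unit I G).comp (eB G : _ →L[ℂ] L1 (Option (Unit × G × Unit)))

/-- Right action on `P`. -/
def rP (I G : Type) [Mul G] :
    L1 (Option (Unit × G × I)) →L[ℂ] L1 (Brandt I G) →L[ℂ] L1 (Option (Unit × G × I)) :=
  (gm Unit I I G).bilinearComp (ContinuousLinearMap.id ℂ _)
    (eA I G : _ →L[ℂ] L1 (Option (I × G × I)))

/-- Left action on `Q`. -/
def lQ (I G : Type) [Mul G] :
    L1 (Brandt I G) →L[ℂ] L1 (Option (I × G × Unit)) →L[ℂ] L1 (Option (I × G × Unit)) :=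
  (gm I I Unit G).comp (eA I G : _ →L[ℂ] L1 (Option (I × G × I)))

/-- Right action on `Q`. -/
def rQ (I G : Type) [Mul G] :
    L1 (Option (I × G × Unit)) →L[ℂ] (L1 G × ℂ) →L[ℂ] L1 (Option (I × G × Unit)) :=
  (gm I Unit Unit G).bilinearComp (ContinuousLinearMap.id ℂ _)
    (eB G : _ →L[ℂ] L1 (Option (Unit × G × Unit)))

/-- The pairing `P × Q → B`. -/
def pairB (I G : Type) [Mul G] :
    L1 (Option (Unit × G × I)) →L[ℂ] L1 (Option (I × G × Unit)) →L[ℂ] (L1 G × ℂ) :=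
  (ContinuousLinearMap.compL ℂ _ _ _ ((eB G).symm : _ →L[ℂ] L1 G × ℂ)).comp (gm Unit I Unit G)

/-- The pairing `Q × P → A`. -/
def pairA (I G : Type) [Mul G] :
    L1 (Option (I × G × Unit)) →L[ℂ] L1 (Option (Unit × G × I)) →L[ℂ] L1 (Brandt I G) :=
  (ContinuousLinearMap.compL ℂ _ _ _ ((eA I G).symm : _ →L[ℂ] L1 (Brandt I G))).comp
    (gm I Unit I G)

theorem lP_apply {I G : Type} [Mul G] (b x) : lP I G b x = gm _ _ _ _ (eB G b) x := rfl

theorem rP_apply {I G : Type} [Mul G] (x a) : rP I G x a = gm _ _ _ _ x (eA I G a) := rfl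

theorem lQ_apply {I G : Type} [Mul G] (a x) : lQ I G a x = gm _ _ _ _ (eA I G a) x := rfl

theorem rQ_apply {I G : Type} [Mul G] (x b) : rQ I G x b = gm _ _ _ _ x (eB G b) := rfl

theorem pairB_apply {I G : Type} [Mul G] (x y) :
    eB G (pairB I G x y) = gm Unit I Unit G x y :=
  ContinuousLinearEquiv.apply_symm_apply _ _

theorem pairA_apply {I G : Type} [Mul G] (x y) :
    eA I G (pairA I G x y) = gm I Unit I G x y :=
  ContinuousLinearEquiv.apply_symm_apply _ _

theorem lawP (I G : Type) [Group G] :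
    IsBimoduleLaw (mulB G) (conv (Brandt I G)) (lP I G) (rP I G) := by
  refine ⟨fun a a' x => ?_, fun x b b' => ?_, fun a x b => ?_⟩
  · rw [lP_apply, lP_apply, lP_apply, mulB_eB, gm_assoc]
  · rw [rP_apply, rP_apply, rP_apply, eA_mul, gm_assoc]
  · rw [rP_apply, lP_apply, rP_apply, lP_apply, gm_assoc]

theorem lawQ (I G : Type) [Group G] :
    IsBimoduleLaw (conv (Brandt I G)) (mulB G) (lQ I G) (rQ I G) := by
  refine ⟨fun a a' x => ?_, fun x b b' => ?_, fun a x b => ?_⟩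
  · rw [lQ_apply, lQ_apply, lQ_apply, eA_mul, gm_assoc]
  · rw [rQ_apply, rQ_apply, rQ_apply, mulB_eB, gm_assoc]
  · rw [rQ_apply, lQ_apply, rQ_apply, lQ_apply, gm_assoc]

theorem indPl (I G : Type) [Group G] : LeftInduced (mulB G) (lP I G) := by
  intro T _ _ φ h
  exact gm_iso (eB G) (ContinuousLinearEquiv.refl ℂ _) (ContinuousLinearEquiv.refl ℂ _) (eB G)
    (fun a b => mulB G a b) (fun a x => lP I G a x) (lP I G)
    (mulB_eB G) lP_apply lP_apply T φ h

theorem indPr (I G : Type) [Nonempty I] [Group G] :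
    RightInduced (conv (Brandt I G)) (rP I G) := by
  intro T _ _ φ h
  exact gm_iso (ContinuousLinearEquiv.refl ℂ _) (eA I G) (ContinuousLinearEquiv.refl ℂ _) (eA I G)
    (fun x a => rP I G x a) (fun a b => conv (Brandt I G) a b) (rP I G)
    rP_apply (eA_mul I G) rP_apply T φ h

theorem indQl (I G : Type) [Nonempty I] [Group G] :
    LeftInduced (conv (Brandt I G)) (lQ I G) := by
  intro T _ _ φ h
  exact gm_iso (eA I G) (ContinuousLinearEquiv.refl ℂ _) (ContinuousLinearEquiv.refl ℂ _) (eA I G)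
    (fun a b => conv (Brandt I G) a b) (fun a x => lQ I G a x) (lQ I G)
    (eA_mul I G) lQ_apply lQ_apply T φ h

theorem indQr (I G : Type) [Group G] : RightInduced (mulB G) (rQ I G) := by
  intro T _ _ φ h
  exact gm_iso (ContinuousLinearEquiv.refl ℂ _) (eB G) (ContinuousLinearEquiv.refl ℂ _) (eB G)
    (fun x a => rQ I G x a) (fun a b => mulB G a b) (rQ I G)
    rQ_apply (mulB_eB G) rQ_apply T φ h

theorem isoB (I G : Type) [Nonempty I] [Group G]
    (T : Type) [SeminormedAddCommGroup T] [NormedSpace ℂ T]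
    (φ : L1 (Option (Unit × G × I)) →ₗ[ℂ] L1 (Option (I × G × Unit)) →ₗ[ℂ] T)
    (h : IsProjTensor _ _ T φ) :
    ∃ e : (T ⧸ balancer φ (fun x a => rP I G x a) (fun a y => lQ I G a y)) ≃L[ℂ] (L1 G × ℂ),
      (∀ b p q, e (Submodule.Quotient.mk (φ (lP I G b p) q))
          = mulB G b (e (Submodule.Quotient.mk (φ p q)))) ∧
      (∀ b p q, e (Submodule.Quotient.mk (φ p (rQ I G q b)))
          = mulB G (e (Submodule.Quotient.mk (φ p q))) b) := by
  obtain ⟨e, he⟩ := gm_iso (ContinuousLinearEquiv.refl ℂ _) (ContinuousLinearEquiv.refl ℂ _)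
    (eB G) (eA I G) (fun x a => rP I G x a) (fun a y => lQ I G a y) (pairB I G)
    rP_apply lQ_apply pairB_apply T φ h
  refine ⟨e, fun b p q => ?_, fun b p q => ?_⟩
  · rw [he, he]
    apply (eB G).injective
    rw [mulB_eB, pairB_apply, pairB_apply, lP_apply, gm_assoc]
  · rw [he, he]
    apply (eB G).injective
    rw [mulB_eB, pairB_apply, pairB_apply, rQ_apply, gm_assoc]

theorem isoA (I G : Type) [Group G]
    (T : Type) [SeminormedAddCommGroup T] [NormedSpace ℂ T]
    (φ : L1 (Option (I × G × Unit)) →ₗ[ℂ] L1 (Option (Unit × G × I)) →ₗ[ℂ] T)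
    (h : IsProjTensor _ _ T φ) :
    ∃ e : (T ⧸ balancer φ (fun y b => rQ I G y b) (fun b x => lP I G b x)) ≃L[ℂ] L1 (Brandt I G),
      (∀ a q p, e (Submodule.Quotient.mk (φ (lQ I G a q) p))
          = conv (Brandt I G) a (e (Submodule.Quotient.mk (φ q p)))) ∧
      (∀ a q p, e (Submodule.Quotient.mk (φ q (rP I G p a)))
          = conv (Brandt I G) (e (Submodule.Quotient.mk (φ q p))) a) := by
  obtain ⟨e, he⟩ := gm_iso (ContinuousLinearEquiv.refl ℂ _) (ContinuousLinearEquiv.refl ℂ _)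
    (eA I G) (eB G) (fun y b => rQ I G y b) (fun b x => lP I G b x) (pairA I G)
    rQ_apply lP_apply pairA_apply T φ h
  refine ⟨e, fun a q p => ?_, fun a q p => ?_⟩
  · rw [he, he]
    apply (eA I G).injective
    rw [eA_mul, pairA_apply, pairA_apply, lQ_apply, gm_assoc]
  · rw [he, he]
    apply (eA I G).injective
    rw [eA_mul, pairA_apply, pairA_apply, rP_apply, gm_assoc]

/-- The Morita context. -/
def witness (I G : Type) [Nonempty I] [Group G] :
    MoritaWitness (L1 (Brandt I G)) (L1 G × ℂ) (conv (Brandt I G)) (mulB G) where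
  P := L1 (Option (Unit × G × I))
  Q := L1 (Option (I × G × Unit))
  lP := lP I G
  rP := rP I G
  lQ := lQ I G
  rQ := rQ I G
  lawP := lawP I G
  lawQ := lawQ I G
  indPl := indPl I G
  indPr := indPr I G
  indQl := indQl I G
  indQr := indQr I G
  isoB := isoB I G
  isoA := isoA I G

theorem selfInduced (I G : Type) [Nonempty I] [Group G] : SelfInduced (conv (Brandt I G)) := by
  intro T _ _ φ h
  obtain ⟨e, he⟩ := gm_iso (eA I G) (eA I G) (eA I G) (eA I G) _ _ _
      (eA_mul I G) (eA_mul I G) (eA_mul I G) T φ h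
  refine ⟨e, he, fun c a b => ?_, fun a b c => ?_⟩
  · refine (he _ _).trans (Eq.trans ?_ (congrArg (conv _ c) (he a b).symm))
    apply (eA I G).injective
    rw [eA_mul, eA_mul, eA_mul, eA_mul]
    exact gm_assoc _ _ _
  · refine (he _ _).trans (Eq.trans ?_ (congrArg (fun u => conv _ u c) (he a b).symm))
    apply (eA I G).injective
    rw [eA_mul, eA_mul, eA_mul, eA_mul]
    exact (gm_assoc _ _ _).symm

end BrandtAux

/-- For a discrete group `G` and a nonempty set `I`, the Brandt
semigroup algebra `ℓ¹(B(I,G))` is self-induced and Morita equivalent (in the sense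
of Grønbæk) to `ℓ¹(G) ⊕ ℂ` with coordinatewise multiplication. -/
theorem brandt_morita_stmt11 (I G : Type) [Nonempty I] [Group G] :
    ∃ (mulS : L1 (Brandt I G) →L[ℂ] L1 (Brandt I G) →L[ℂ] L1 (Brandt I G))
      (mulG : L1 G →L[ℂ] L1 G →L[ℂ] L1 G)
      (mulGC : (L1 G × ℂ) →L[ℂ] (L1 G × ℂ) →L[ℂ] (L1 G × ℂ)),
      (∀ (a b : L1 (Brandt I G)) (s : Brandt I G), mulS a b s = l1conv a b s) ∧
      (∀ (x y : L1 G) (g : G), mulG x y g = l1conv x y g) ∧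
      (∀ p q : L1 G × ℂ, mulGC p q = (mulG p.1 q.1, p.2 * q.2)) ∧
      SelfInduced mulS ∧
      MoritaEquivalent mulS mulGC := by
  exact ⟨BrandtAux.conv _, BrandtAux.conv _, BrandtAux.mulB G, BrandtAux.conv_apply,
    BrandtAux.conv_apply, BrandtAux.mulB_apply G, BrandtAux.selfInduced I G,
    ⟨BrandtAux.witness I G⟩⟩
end
end
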